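/- Let G be a TLG on {1,…,N} (N ≥ 3) in which vertex 1 is adjacent exactly to vertices 2 and 3 and (2,3) ∈ E, let (f_ij) ∈ 𝓕^{|E|}, and let p be an equilibrium line configuration on the a-axis with distances d_12, d_13. Let d̃F_{p*} be the matrix formed for the reduced system associated with p at p* = (x_2,…,x_N). Then 𝐧(d̃F_p) − 𝐧(d̃F_{p*}) = sgn(−f̃′_12(d_12) − f̃′_13(d_13)). -/

import Mathlib

open Set Filter Topology MeasureTheory Matrix Function

attribute [local instance] Classical.propDecidable

noncomputable section

/-- `f̃(d) = d * f(d)`. -/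
def tildeFn (f : ℝ → ℝ) : ℝ → ℝ := fun d => d * f d

/-- Membership in the class `𝓕` of monotone interaction laws:
`f` is `C¹` on `ℝ₊ = (0,∞)`, `f̃′ > 0` on `ℝ₊`, `f̃` has a zero, and
`∫_d^1 f̃(x) dx → −∞` as `d → 0⁺`. -/
def MemF (f : ℝ → ℝ) : Prop :=
  ContDiffOn ℝ 1 f (Set.Ioi 0) ∧
  (∀ d > (0:ℝ), 0 < deriv (tildeFn f) d) ∧
  (∃ d > (0:ℝ), tildeFn f d = 0) ∧
  Tendsto (fun d => ∫ x in d..(1:ℝ), tildeFn f x) (𝓝[>] (0:ℝ)) atBot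

/-- The space `C¹(ℝ₊, ℝ)`. -/
def C1Pos : Type := {f : ℝ → ℝ // ContDiffOn ℝ 1 f (Set.Ioi 0)}

/-- The Whitney `C¹`-topology on `C¹(ℝ₊, ℝ)`, generated by the basic open sets
`B_δ(f) = {g : |g(d) − f(d)| + |g′(d) − f′(d)| < δ(d) for all d > 0}`. -/
instance : TopologicalSpace C1Pos :=
  TopologicalSpace.generateFrom
    { S | ∃ (f : C1Pos) (δ : ℝ → ℝ), ContinuousOn δ (Set.Ioi 0) ∧ (∀ d > (0:ℝ), 0 < δ d) ∧
        S = { g : C1Pos | ∀ d > (0:ℝ), |g.1 d - f.1 d| + |deriv g.1 d - deriv f.1 d| < δ d } }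

/-- The class `𝓕` as a topological space (subspace of `C¹(ℝ₊,ℝ)`). -/
def FF : Type := {f : C1Pos // MemF f.1}

instance : TopologicalSpace FF := instTopologicalSpaceSubtype

/-- `G` is a triangulated Laman graph: there is a Henneberg-type construction order
(a relabeling `σ`) starting from the edge between the first two vertices, in which every
later vertex is joined to exactly two earlier, adjacent, vertices. -/
def IsTLG {N : ℕ} (G : SimpleGraph (Fin N)) : Prop :=
  2 ≤ N ∧
  ∃ (σ : Equiv.Perm (Fin N)) (par₁ par₂ : Fin N → Fin N),
    (∀ k : Fin N, 2 ≤ (k : ℕ) →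
      ((par₁ k : ℕ) < (k : ℕ) ∧ (par₂ k : ℕ) < (k : ℕ) ∧ par₁ k ≠ par₂ k ∧
        G.Adj (σ (par₁ k)) (σ (par₂ k)))) ∧
    (∀ i j : Fin N, G.Adj (σ i) (σ j) ↔
      (((i : ℕ) = 0 ∧ (j : ℕ) = 1) ∨ ((i : ℕ) = 1 ∧ (j : ℕ) = 0) ∨
       (2 ≤ (i : ℕ) ∧ (j = par₁ i ∨ j = par₂ i)) ∨
       (2 ≤ (j : ℕ) ∧ (i = par₁ j ∨ i = par₂ j))))

/-- Euclidean distance on `ℝ²` (coordinates `(a,b)`). -/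
def dist2 (x y : ℝ × ℝ) : ℝ := Real.sqrt ((x.1 - y.1)^2 + (x.2 - y.2)^2)

/-- `p` belongs to the configuration space `P`: no collision of adjacent agents. -/
def InConfigSpace {N : ℕ} (G : SimpleGraph (Fin N)) (p : Fin N → ℝ × ℝ) : Prop :=
  ∀ i j, G.Adj i j → p i ≠ p j

/-- `p` is an equilibrium of the RMA system `ẋᵢ = Σ_{j : (i,j) ∈ E} f_ij(d_ij)(x_j − x_i)`. -/
def IsEquilibrium {N : ℕ} (G : SimpleGraph (Fin N)) (f : Fin N → Fin N → ℝ → ℝ)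
    (p : Fin N → ℝ × ℝ) : Prop :=
  ∀ i, (∑ j, if G.Adj i j then (f i j (dist2 (p i) (p j))) • (p j - p i) else (0:ℝ×ℝ)) = 0

/-- The potential function `Φ(p) = Σ_{(i,j) ∈ E} ∫_1^{d_ij} x f_ij(x) dx`
(each edge counted once; the factor 1/2 compensates the double count over ordered pairs). -/
def potential {N : ℕ} (G : SimpleGraph (Fin N)) (f : Fin N → Fin N → ℝ → ℝ)
    (p : Fin N → ℝ × ℝ) : ℝ :=
  (1/2) * ∑ i, ∑ j, if G.Adj i j then ∫ x in (1:ℝ)..(dist2 (p i) (p j)), x * f i j x else 0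

/-- Coordinate directions on the configuration space, in the order `(a₁,…,a_N,b₁,…,b_N)`. -/
def basisVec {N : ℕ} : (Fin N ⊕ Fin N) → (Fin N → ℝ × ℝ) :=
  Sum.elim (fun i => Pi.single i ((1:ℝ), (0:ℝ))) (fun i => Pi.single i ((0:ℝ), (1:ℝ)))

/-- The Hessian matrix of `Φ` at `p` in the coordinates `(a₁,…,a_N,b₁,…,b_N)`. -/
def hessian {N : ℕ} (Φ : (Fin N → ℝ × ℝ) → ℝ) (p : Fin N → ℝ × ℝ) :
    Matrix (Fin N ⊕ Fin N) (Fin N ⊕ Fin N) ℝ :=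
  Matrix.of fun u v => fderiv ℝ (fun q => fderiv ℝ Φ q (basisVec v)) p (basisVec u)

/-- The inertia `𝐧(M) = (n₊(M), n₀(M), n₋(M))` of a real symmetric matrix: the numbers of
positive, zero, and negative eigenvalues (counted with multiplicity). -/
def inertia {m : Type*} [Fintype m] [DecidableEq m] (M : Matrix m m ℝ) : ℕ × ℕ × ℕ :=
  if h : M.IsHermitian then
    ((Finset.univ.filter fun i => 0 < h.eigenvalues i).card,
     (Finset.univ.filter fun i => h.eigenvalues i = 0).card,
     (Finset.univ.filter fun i => h.eigenvalues i < 0).card)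
  else (0, 0, 0)

/-- The number `n₀(M)` of zero eigenvalues of a real symmetric matrix. -/
def n0 {m : Type*} [Fintype m] [DecidableEq m] (M : Matrix m m ℝ) : ℕ := (inertia M).2.1

/-- The vector-valued sign function. -/
def sgn3 (x : ℝ) : ℕ × ℕ × ℕ :=
  if 0 < x then (1,0,0) else if x = 0 then (0,1,0) else (0,0,1)

/-- `q` lies in the `SE(2)`-orbit of `p` (rigid motions: rotation by `(c,s)` with
`c² + s² = 1` followed by translation by `(vx,vy)`). -/
def sameOrbit {N : ℕ} (p q : Fin N → ℝ × ℝ) : Prop :=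
  ∃ c s vx vy : ℝ, c^2 + s^2 = 1 ∧
    ∀ i, q i = (c * (p i).1 - s * (p i).2 + vx, s * (p i).1 + c * (p i).2 + vy)

/-- The interaction laws determined by an ensemble `ω ∈ 𝓕^{|E|}`. -/
def ensembleLaws {N : ℕ} {G : SimpleGraph (Fin N)} (ω : G.edgeSet → FF) :
    Fin N → Fin N → ℝ → ℝ :=
  fun i j => if h : G.Adj i j then (ω ⟨s(i,j), G.mem_edgeSet.mpr h⟩).1.1 else 0

/-- The line configuration on the `a`-axis with coordinates `a`. -/
def lineConfig {N : ℕ} (a : Fin N → ℝ) : Fin N → ℝ × ℝ := fun i => (a i, 0)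

/-- The matrix `F_p` of a line configuration with coordinates `a`: symmetric, zero row sums,
off-diagonal entries `φ_ij(d_ij)` on edges and `0` otherwise. -/
def FMat {N : ℕ} (G : SimpleGraph (Fin N)) (φ : Fin N → Fin N → ℝ → ℝ)
    (a : Fin N → ℝ) : Matrix (Fin N) (Fin N) ℝ :=
  Matrix.of fun i j =>
    if i = j then -∑ k, (if G.Adj i k then φ i k |a i - a k| else 0)
    else if G.Adj i j then φ i j |a i - a j| else 0

/-- The matrix `d̃F_p`: off-diagonal entries `f̃′_ij(d_ij)` on edges. -/
def dFMat {N : ℕ} (G : SimpleGraph (Fin N)) (f : Fin N → Fin N → ℝ → ℝ)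
    (a : Fin N → ℝ) : Matrix (Fin N) (Fin N) ℝ :=
  FMat G (fun i j d => deriv (tildeFn (f i j)) d) a

/-- Case 1 balanced distance: the (generically unique) `d₁₂(d)` with `0 < d₁₂ < d` and
`f̃₁₂(d₁₂) = f̃₁₃(d − d₁₂)`. -/
def case1d12 (f12 f13 : ℝ → ℝ) (d : ℝ) : ℝ :=
  Classical.epsilon fun t => 0 < t ∧ t < d ∧ tildeFn f12 t = tildeFn f13 (d - t)

/-- The case-1 virtual interaction: `g̃₂₃(d) = f̃₁₂(d₁₂(d))`. -/
def g23Case1 (f12 f13 : ℝ → ℝ) : ℝ → ℝ :=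
  fun d => tildeFn f12 (case1d12 f12 f13 d) / d

/-- Case 2 balanced distance: the (generically unique) `d₁₂(d) > 0` with
`f̃₁₂(d₁₂) + f̃₁₃(d₁₂ + d) = 0`. -/
def case2d12 (f12 f13 : ℝ → ℝ) (d : ℝ) : ℝ :=
  Classical.epsilon fun t => 0 < t ∧ tildeFn f12 t + tildeFn f13 (t + d) = 0

/-- The case-2 virtual interaction: `g̃₂₃(d) = f̃₁₃(d₁₃(d))`, `d₁₃(d) = d₁₂(d) + d`. -/
def g23Case2 (f12 f13 : ℝ → ℝ) : ℝ → ℝ :=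
  fun d => tildeFn f13 (case2d12 f12 f13 d + d) / d

/-- The case-3 virtual interaction: case 2 with the roles of agents 2,3 (and `f₁₂`,`f₁₃`)
interchanged. -/
def g23Case3 (f12 f13 : ℝ → ℝ) : ℝ → ℝ := g23Case2 f13 f12

/-- The virtual interaction between agents 2 and 3 induced by `f₁₂`, `f₁₃`, chosen according
to which of the three aligned agents (at coordinates `a1`, `a2`, `a3`) lies between the
other two. -/
def virtualG (f12 f13 : ℝ → ℝ) (a1 a2 a3 : ℝ) : ℝ → ℝ :=
  if (a2 < a1 ∧ a1 < a3) ∨ (a3 < a1 ∧ a1 < a2) then g23Case1 f12 f13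
  else if (a1 < a2 ∧ a2 < a3) ∨ (a3 < a2 ∧ a2 < a1) then g23Case2 f12 f13
  else g23Case3 f12 f13

/-- The interaction laws of the reduced system: vertex `0` (the last Henneberg vertex,
the paper's vertex 1) is deleted, reduced vertex `i` is original vertex `i+1`, and the law on
the reduced edge `(0,1)` (the paper's edge `(2,3)`) is `f*₂₃ = f₂₃ + g₂₃`. -/
def reducedLaws {n : ℕ} (f : Fin (n+3) → Fin (n+3) → ℝ → ℝ) (g : ℝ → ℝ) :
    Fin (n+2) → Fin (n+2) → ℝ → ℝ :=
  fun i j => if (i = 0 ∧ j = 1) ∨ (i = 1 ∧ j = 0)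
    then fun d => f i.succ j.succ d + g d
    else f i.succ j.succ

end

/-! ### Inertia and Schur complements -/

theorem dotProduct_mulVec_eq_sum_eigenvalues {m : Type*} [Fintype m] [DecidableEq m]
    {M : Matrix m m ℝ} (hM : M.IsHermitian) :
    ∃ e : (m → ℝ) ≃ₗ[ℝ] (m → ℝ),
      ∀ x, ∑ i, hM.eigenvalues i * (e x i * e x i) = x ⬝ᵥ (M *ᵥ x) := by
  let U : Matrix m m ℝ := (hM.eigenvectorUnitary : Matrix m m ℝ)
  have h1 : Uᵀ * U = 1 := Unitary.coe_star_mul_self hM.eigenvectorUnitary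
  have h2 : U * Uᵀ = 1 := Unitary.coe_mul_star_self hM.eigenvectorUnitary
  have hs : M = U * diagonal hM.eigenvalues * Uᵀ := by
    have := hM.spectral_theorem
    rw [Unitary.conjStarAlgAut_apply] at this
    exact this
  refine ⟨LinearEquiv.ofLinearMap (Matrix.toLin' Uᵀ) (Matrix.toLin' U) ?_ ?_, fun x => ?_⟩
  · rw [← Matrix.toLin'_mul, h1, Matrix.toLin'_one]
  · rw [← Matrix.toLin'_mul, h2, Matrix.toLin'_one]
  · conv_rhs => rw [hs]
    rw [← Matrix.mulVec_mulVec, ← Matrix.mulVec_mulVec, Matrix.dotProduct_mulVec,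
      ← Matrix.mulVec_transpose]
    simp only [dotProduct, Matrix.mulVec_diagonal, LinearEquiv.coe_ofLinearMap,
      Matrix.toLin'_apply]
    exact Finset.sum_congr rfl fun i _ => by ring

theorem card_filter_pos_add_zero_add_neg {ι : Type*} [Fintype ι] (w : ι → ℝ) :
    (Finset.univ.filter fun i => 0 < w i).card + (Finset.univ.filter fun i => w i = 0).card
      + (Finset.univ.filter fun i => w i < 0).card = Fintype.card ι := by
  rw [← Finset.card_univ, Finset.card_eq_sum_ones Finset.univ]
  simp only [Finset.card_filter, ← Finset.sum_add_distrib]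
  refine Finset.sum_congr rfl fun i _ => ?_
  rcases lt_trichotomy (w i) 0 with h | h | h
  · simp [h, h.ne, h.le.not_gt]
  · simp [h]
  · simp [h, h.ne', h.le.not_gt]

/-- The congruence class of the quadratic form of a Hermitian matrix determines its inertia. -/
theorem inertia_eq_of_equivalent {m ι : Type*} [Fintype m] [DecidableEq m] [Fintype ι]
    {M : Matrix m m ℝ} (hM : M.IsHermitian) {w : ι → ℝ} (e : (m → ℝ) ≃ₗ[ℝ] (ι → ℝ))
    (he : ∀ x, ∑ i, w i * (e x i * e x i) = x ⬝ᵥ (M *ᵥ x)) :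
    inertia M = ((Finset.univ.filter fun i => 0 < w i).card,
      (Finset.univ.filter fun i => w i = 0).card,
      (Finset.univ.filter fun i => w i < 0).card) := by
  obtain ⟨e', he'⟩ := dotProduct_mulVec_eq_sum_eigenvalues hM
  have hE : QuadraticMap.Equivalent (QuadraticMap.weightedSumSquares ℝ hM.eigenvalues)
      (QuadraticMap.weightedSumSquares ℝ w) := by
    refine ⟨⟨e'.symm.trans e, fun x => ?_⟩⟩
    have h1 := he (e'.symm x)
    have h2 := he' (e'.symm x)
    rw [e'.apply_symm_apply] at h2
    simp only [QuadraticMap.weightedSumSquares_apply, smul_eq_mul]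
    exact h1.trans h2.symm
  have hpos := hE.sigPos_eq
  have hneg := hE.sigNeg_eq
  have hcard : Fintype.card m = Fintype.card ι := by
    simpa using e.finrank_eq
  rw [QuadraticForm.sigPos_weightedSumSquares, QuadraticForm.sigPos_weightedSumSquares,
    ← Finset.coe_filter_univ, ← Finset.coe_filter_univ, Set.ncard_coe_finset,
    Set.ncard_coe_finset] at hpos
  rw [QuadraticForm.sigNeg_weightedSumSquares, QuadraticForm.sigNeg_weightedSumSquares,
    ← Finset.coe_filter_univ, ← Finset.coe_filter_univ, Set.ncard_coe_finset,
    Set.ncard_coe_finset] at hneg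
  have hsum := card_filter_pos_add_zero_add_neg hM.eigenvalues
  have hsum' := card_filter_pos_add_zero_add_neg w
  rw [inertia, dif_pos hM, Prod.mk.injEq, Prod.mk.injEq]
  exact ⟨hpos, by omega, hneg⟩

/-- Inertia additivity (Haynsworth) for a one-dimensional pivot block. -/
theorem inertia_eq_add_sgn3_of_schur {n : ℕ} {M : Matrix (Fin (n + 1)) (Fin (n + 1)) ℝ}
    {S : Matrix (Fin n) (Fin n) ℝ} (hM : M.IsHermitian) (hS : S.IsHermitian) {c : ℝ}
    (hc : c ≠ 0) (h0 : M 0 0 = c)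
    (h : ∀ i j, M i.succ j.succ = S i j + c⁻¹ * M 0 i.succ * M 0 j.succ) :
    inertia M = inertia S + sgn3 c := by
  obtain ⟨e, he⟩ := dotProduct_mulVec_eq_sum_eigenvalues hS
  let L : (Fin n → ℝ) →ₗ[ℝ] ℝ :=
    ∑ i, (c⁻¹ * M 0 i.succ) • LinearMap.proj (R := ℝ) (φ := fun _ => ℝ) i
  have hL : ∀ x, L x = ∑ i, c⁻¹ * M 0 i.succ * x i := fun x => by
    simp [L, LinearMap.sum_apply]
  let E : (Fin (n + 1) → ℝ) ≃ₗ[ℝ] (Fin (n + 1) → ℝ) :=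
    { toFun := fun x => Fin.cons (x 0 + L (Fin.tail x)) (e (Fin.tail x))
      invFun := fun y => Fin.cons (y 0 - L (e.symm (Fin.tail y))) (e.symm (Fin.tail y))
      map_add' := fun x y => by
        have ht : Fin.tail (x + y) = Fin.tail x + Fin.tail y := rfl
        funext i
        refine Fin.cases ?_ (fun j => ?_) i
        · simp only [ht, map_add, Fin.cons_zero, Pi.add_apply]
          ring
        · simp only [ht, map_add, Fin.cons_succ, Pi.add_apply]
      map_smul' := fun r x => by
        have ht : Fin.tail (r • x) = r • Fin.tail x := rfl
        funext i
        refine Fin.cases ?_ (fun j => ?_) i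
        · simp only [ht, map_smul, Fin.cons_zero, Pi.smul_apply, smul_eq_mul, RingHom.id_apply]
          ring
        · simp only [ht, map_smul, Fin.cons_succ, Pi.smul_apply, RingHom.id_apply]
      left_inv := fun x => by simp
      right_inv := fun y => by simp }
  have hsymm : ∀ i : Fin n, M i.succ 0 = M 0 i.succ := fun i => hM.apply 0 i.succ
  rw [inertia_eq_of_equivalent hM (w := Fin.cons c hS.eigenvalues) E fun x => ?_]
  · rw [inertia, dif_pos hS, sgn3]
    simp only [Finset.card_filter, Fin.sum_univ_succ, Fin.cons_zero, Fin.cons_succ]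
    rcases lt_trichotomy c 0 with h | h | h
    · simp [h, h.ne, h.le.not_gt, add_comm]
    · exact absurd h hc
    · simp [h, h.ne', h.le.not_gt, add_comm]
  · have h1 := he (Fin.tail x)
    rw [Fin.sum_univ_succ]
    simp only [E, LinearEquiv.coe_mk, LinearMap.coe_mk, AddHom.coe_mk, Fin.cons_zero,
      Fin.cons_succ]
    rw [h1, hL]
    simp only [dotProduct, Matrix.mulVec, Fin.sum_univ_succ (n := n), h0, h, hsymm, Fin.tail]
    have hV : ∑ i : Fin n, c⁻¹ * M 0 i.succ * x i.succ =
        c⁻¹ * ∑ i : Fin n, M 0 i.succ * x i.succ := by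
      rw [Finset.mul_sum]
      exact Finset.sum_congr rfl fun i _ => mul_assoc _ _ _
    have hrow : ∀ i : Fin n,
        x i.succ * (M 0 i.succ * x 0 + ∑ j : Fin n,
            (S i j + c⁻¹ * M 0 i.succ * M 0 j.succ) * x j.succ) =
          (M 0 i.succ * x i.succ) * (x 0 + c⁻¹ * ∑ j : Fin n, M 0 j.succ * x j.succ)
            + x i.succ * ∑ j, S i j * x j.succ := by
      intro i
      simp only [add_mul, Finset.sum_add_distrib, mul_assoc, ← Finset.mul_sum]
      ring
    rw [Finset.sum_congr rfl fun i _ => hrow i, Finset.sum_add_distrib, ← Finset.sum_mul, hV]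
    field_simp
    ring

/-! ### Balanced distances and the derivative of the virtual interaction -/

theorem HasStrictDerivAt.exists_localInverse {F : ℝ → ℝ} {α x : ℝ}
    (hF : HasStrictDerivAt F α x) (hα : α ≠ 0) :
    ∃ u : ℝ → ℝ, u (F x) = x ∧ HasDerivAt u α⁻¹ (F x) ∧ HasStrictDerivAt u α⁻¹ (F x) ∧
      ∀ᶠ y in 𝓝 (F x), F (u y) = y :=
  ⟨hF.localInverse F α x hα, (hF.eventually_left_inverse hα).self_of_nhds,
    (hF.to_localInverse hα).hasDerivAt, hF.to_localInverse hα, hF.eventually_right_inverse hα⟩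

/-- Implicit differentiation of the balance condition `F x = H (d - x)`. -/
theorem exists_balanced_point {F H : ℝ → ℝ} {α β x y : ℝ} (hF : HasStrictDerivAt F α x)
    (hH : HasStrictDerivAt H β y) (hα : 0 < α) (hβ : 0 < β) (hxy : F x = H y) :
    ∃ u : ℝ → ℝ, u (x + y) = x ∧ HasDerivAt u (β / (α + β)) (x + y) ∧
      ∀ᶠ d in 𝓝 (x + y), F (u d) = H (d - u d) := by
  obtain ⟨u, hu0, -, hu, hFu⟩ := hF.exists_localInverse hα.ne'
  obtain ⟨w, hw0, -, hw, hHw⟩ := hH.exists_localInverse hβ.ne'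
  rw [← hxy] at hw0 hw hHw
  have hD : HasStrictDerivAt (fun s => u s + w s) (α⁻¹ + β⁻¹) (F x) := hu.add hw
  obtain ⟨s, hs0, hs, -, hDs⟩ := hD.exists_localInverse (by positivity)
  simp only [hu0, hw0] at hs0 hs hDs
  have hst : Tendsto s (𝓝 (x + y)) (𝓝 (F x)) := by
    simpa [hs0] using hs.continuousAt.tendsto
  refine ⟨fun d => u (s d), by simp only [hs0, hu0], ?_, ?_⟩
  · have h := HasDerivAt.comp (x + y) (h₂ := u) (h := s) (by rw [hs0]; exact hu.hasDerivAt) hs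
    convert! h using 1
    field_simp
    ring
  · filter_upwards [hst.eventually hFu, hst.eventually hHw, hDs] with d h1 h2 h3
    rw [h1, show d - u (s d) = w (s d) by linarith, h2]

theorem MemF.hasStrictDerivAt {f : ℝ → ℝ} (hf : MemF f) {d : ℝ} (hd : 0 < d) :
    HasStrictDerivAt (tildeFn f) (deriv (tildeFn f) d) d := by
  have h : ContDiffAt ℝ 1 (tildeFn f) d :=
    contDiffAt_id.mul (hf.1.contDiffAt (Ioi_mem_nhds hd))
  exact h.hasStrictDerivAt one_ne_zero

theorem MemF.strictMonoOn {f : ℝ → ℝ} (hf : MemF f) : StrictMonoOn (tildeFn f) (Ioi 0) := by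
  refine strictMonoOn_of_deriv_pos (convex_Ioi 0)
    (fun d hd => (hf.hasStrictDerivAt hd).hasDerivAt.continuousAt.continuousWithinAt) ?_
  intro d hd
  rw [interior_Ioi] at hd
  exact hf.2.1 d hd

theorem hasDerivAt_tildeFn_g23Case1 {f g : ℝ → ℝ} (hf : MemF f) (hg : MemF g) {x y : ℝ}
    (hx : 0 < x) (hy : 0 < y) (hxy : tildeFn f x = tildeFn g y) :
    HasDerivAt (tildeFn (g23Case1 f g))
      (deriv (tildeFn f) x * deriv (tildeFn g) y
        / (deriv (tildeFn f) x + deriv (tildeFn g) y)) (x + y) := by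
  obtain ⟨u, hu0, hu, hbal⟩ := exists_balanced_point (hf.hasStrictDerivAt hx)
    (hg.hasStrictDerivAt hy) (hf.2.1 x hx) (hg.2.1 y hy) hxy
  have hcomp : HasDerivAt (fun d => tildeFn f (u d)) (deriv (tildeFn f) x * _) (x + y) :=
    HasDerivAt.comp (x + y) (h₂ := tildeFn f) (h := u)
      (by rw [hu0]; exact (hf.hasStrictDerivAt hx).hasDerivAt) hu
  rw [mul_div_assoc]
  refine hcomp.congr_of_eventuallyEq ?_
  have hpos : ∀ᶠ d in 𝓝 (x + y), 0 < u d :=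
    hu.continuousAt.eventually (Ioi_mem_nhds (by rwa [hu0]))
  have hlt : ∀ᶠ d in 𝓝 (x + y), u d < d :=
    hu.continuousAt.eventually_lt continuousAt_id (by simp only [hu0]; linarith)
  filter_upwards [hbal, hpos, hlt] with d h1 h2 h3
  obtain ⟨c1, c2, c3⟩ : 0 < case1d12 f g d ∧ case1d12 f g d < d ∧
      tildeFn f (case1d12 f g d) = tildeFn g (d - case1d12 f g d) :=
    Classical.epsilon_spec
      (p := fun t => 0 < t ∧ t < d ∧ tildeFn f t = tildeFn g (d - t)) ⟨u d, h2, h3, h1⟩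
  have huniq : case1d12 f g d = u d := by
    rcases lt_trichotomy (case1d12 f g d) (u d) with h | h | h
    · have h4 := hf.strictMonoOn c1 h2 h
      have h5 := hg.strictMonoOn (show 0 < d - u d by linarith)
        (show 0 < d - case1d12 f g d by linarith) (by linarith)
      linarith
    · exact h
    · have h4 := hf.strictMonoOn h2 c1 h
      have h5 := hg.strictMonoOn (show 0 < d - case1d12 f g d by linarith)
        (show 0 < d - u d by linarith) (by linarith)
      linarith
  rw [tildeFn, g23Case1, huniq, mul_div_cancel₀ _ (h2.trans h3).ne']

theorem hasDerivAt_tildeFn_g23Case2 {f g : ℝ → ℝ} (hf : MemF f) (hg : MemF g) {x y : ℝ}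
    (hx : 0 < x) (hxy : x < y) (heq : tildeFn f x + tildeFn g y = 0) :
    HasDerivAt (tildeFn (g23Case2 f g))
      (deriv (tildeFn f) x * deriv (tildeFn g) y
        / (deriv (tildeFn f) x + deriv (tildeFn g) y)) (y - x) := by
  have hy : 0 < y := hx.trans hxy
  have hα := hf.2.1 x hx
  have hβ := hg.2.1 y hy
  have hF : HasStrictDerivAt (fun t => -tildeFn f (-t)) (deriv (tildeFn f) x) (-x) := by
    have h := (HasStrictDerivAt.comp (-x) (h₂ := tildeFn f) (h := fun t => -t)
      (by rw [neg_neg]; exact hf.hasStrictDerivAt hx) (hasStrictDerivAt_id (-x)).neg).neg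
    simpa [Function.comp_def] using! h
  obtain ⟨u, hu0, hu, hbal⟩ := exists_balanced_point hF (hg.hasStrictDerivAt hy) hα hβ
    (by rw [neg_neg]; linarith)
  rw [neg_add_eq_sub] at hu0 hu hbal
  have hcomp := HasDerivAt.comp (y - x) (h₂ := tildeFn g) (h := fun d => d - u d)
      (by rw [hu0, show y - x - -x = y by ring]; exact (hg.hasStrictDerivAt hy).hasDerivAt)
      ((hasDerivAt_id (y - x)).sub hu)
  have hval : deriv (tildeFn f) x * deriv (tildeFn g) y
        / (deriv (tildeFn f) x + deriv (tildeFn g) y) = deriv (tildeFn g) y *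
        (1 - deriv (tildeFn g) y / (deriv (tildeFn f) x + deriv (tildeFn g) y)) := by
    field_simp
    ring
  rw [hval]
  refine hcomp.congr_of_eventuallyEq ?_
  have hneg : ∀ᶠ d in 𝓝 (y - x), u d < 0 :=
    hu.continuousAt.eventually (Iio_mem_nhds (by rw [hu0]; linarith))
  filter_upwards [hbal, hneg, Ioi_mem_nhds (show 0 < y - x by linarith)] with d h1 h2 h3
  replace h3 : 0 < d := h3
  have h4 : tildeFn f (-u d) + tildeFn g (-u d + d) = 0 := by
    rw [neg_add_eq_sub, ← h1]; ring
  obtain ⟨c1, c2⟩ : 0 < case2d12 f g d ∧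
      tildeFn f (case2d12 f g d) + tildeFn g (case2d12 f g d + d) = 0 :=
    Classical.epsilon_spec
      (p := fun t => 0 < t ∧ tildeFn f t + tildeFn g (t + d) = 0) ⟨-u d, by linarith, h4⟩
  have hu' : 0 < -u d := by linarith
  have huniq : case2d12 f g d = -u d := by
    rcases lt_trichotomy (case2d12 f g d) (-u d) with h | h | h
    · have h5 := hf.strictMonoOn c1 hu' h
      have h6 := hg.strictMonoOn (show 0 < case2d12 f g d + d by linarith)
        (show 0 < -u d + d by linarith) (by linarith)
      linarith
    · exact h
    · have h5 := hf.strictMonoOn hu' c1 h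
      have h6 := hg.strictMonoOn (show 0 < -u d + d by linarith)
        (show 0 < case2d12 f g d + d by linarith) (by linarith)
      linarith
  rw [tildeFn, g23Case2, huniq, mul_div_cancel₀ _ h3.ne', neg_add_eq_sub]
  rfl

/-- The derivative of the virtual interaction is the harmonic combination of those of the two
deleted interactions, when agent `1` is balanced. -/
theorem hasDerivAt_tildeFn_virtualG {f g : ℝ → ℝ} (hf : MemF f) (hg : MemF g) {a1 a2 a3 : ℝ}
    (h12 : a1 ≠ a2) (h13 : a1 ≠ a3) (h23 : a2 ≠ a3)
    (heq : f |a1 - a2| * (a2 - a1) + g |a1 - a3| * (a3 - a1) = 0) :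
    HasDerivAt (tildeFn (virtualG f g a1 a2 a3))
      (deriv (tildeFn f) |a1 - a2| * deriv (tildeFn g) |a1 - a3|
        / (deriv (tildeFn f) |a1 - a2| + deriv (tildeFn g) |a1 - a3|)) |a2 - a3| := by
  have hx : 0 < |a1 - a2| := abs_pos.2 (sub_ne_zero.2 h12)
  have hy : 0 < |a1 - a3| := abs_pos.2 (sub_ne_zero.2 h13)
  unfold virtualG
  split_ifs with hc1 hc2
  · have hd : |a2 - a3| = |a1 - a2| + |a1 - a3| := by grind
    rw [hd]
    refine hasDerivAt_tildeFn_g23Case1 hf hg hx hy ?_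
    simp only [tildeFn]
    grind
  · have hd : |a2 - a3| = |a1 - a3| - |a1 - a2| := by grind
    rw [hd]
    refine hasDerivAt_tildeFn_g23Case2 hf hg hx (by grind) ?_
    simp only [tildeFn]
    grind
  · have hc3 : (a1 < a3 ∧ a3 < a2) ∨ (a2 < a3 ∧ a3 < a1) := by
      rcases h12.lt_or_gt with h | h <;> rcases h13.lt_or_gt with h' | h' <;>
        rcases h23.lt_or_gt with h'' | h'' <;> simp_all
    have hd : |a2 - a3| = |a1 - a2| - |a1 - a3| := by grind
    rw [hd, mul_comm (deriv (tildeFn f) _), add_comm (deriv (tildeFn f) _)]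
    refine hasDerivAt_tildeFn_g23Case2 hg hf hy (by grind) ?_
    simp only [tildeFn]
    grind

theorem tildeFn_add (f g : ℝ → ℝ) :
    tildeFn (fun d => f d + g d) = fun d => tildeFn f d + tildeFn g d := by
  funext d
  simp only [tildeFn, mul_add]

/-! ### Line configurations of the full and the reduced system -/

theorem sum_neighbors_zero {n : ℕ} {G : SimpleGraph (Fin (n + 3))}
    (h0 : G.neighborSet 0 = {1, 2}) {E : Type*} [AddCommMonoid E] (g : Fin (n + 3) → E) :
    (∑ j, if G.Adj 0 j then g j else 0) = g 1 + g 2 := by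
  have hadj : ∀ j, G.Adj 0 j ↔ j = 1 ∨ j = 2 := fun j => by
    rw [← SimpleGraph.mem_neighborSet, h0]; rfl
  have h12 : (1 : Fin (n + 3)) ≠ 2 := (Fin.succ_injective (n + 2)).ne (Fin.zero_ne_one (n := n))
  rw [← Finset.sum_filter, ← Finset.sum_pair h12]
  congr 1
  ext j
  simp [hadj]

theorem IsEquilibrium.balance_zero {n : ℕ} {G : SimpleGraph (Fin (n + 3))}
    (h0 : G.neighborSet 0 = {1, 2}) {f : Fin (n + 3) → Fin (n + 3) → ℝ → ℝ}
    {a : Fin (n + 3) → ℝ} (heq : IsEquilibrium G f (lineConfig a)) :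
    f 0 1 |a 0 - a 1| * (a 1 - a 0) + f 0 2 |a 0 - a 2| * (a 2 - a 0) = 0 := by
  have h := heq 0
  rw [sum_neighbors_zero h0] at h
  simpa [lineConfig, dist2, Real.sqrt_sq_eq_abs] using congrArg Prod.fst h

theorem FMat_isHermitian {N : ℕ} {G : SimpleGraph (Fin N)} {φ : Fin N → Fin N → ℝ → ℝ}
    (hφ : ∀ i j, φ i j = φ j i) (a : Fin N → ℝ) : (FMat G φ a).IsHermitian := by
  refine Matrix.IsHermitian.ext fun i j => ?_
  by_cases hij : i = j
  · subst hij; rfl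
  · simp only [FMat, Matrix.of_apply, if_neg hij, if_neg (Ne.symm hij), star_trivial,
      G.adj_comm j i, hφ j i, abs_sub_comm (a j)]

theorem dFMat_apply_of_ne {N : ℕ} (G : SimpleGraph (Fin N)) (f : Fin N → Fin N → ℝ → ℝ)
    (a : Fin N → ℝ) {i j : Fin N} (hij : i ≠ j) :
    dFMat G f a i j = if G.Adj i j then deriv (tildeFn (f i j)) |a i - a j| else 0 := by
  simp only [dFMat, FMat, Matrix.of_apply, if_neg hij]

/-- Eliminating vertex `0` from `FMat`: the Schur complement is again of the form `FMat`, with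
the weights of the reduced edges corrected by a rank-one term. -/
theorem FMat_succ_succ {n : ℕ} {G : SimpleGraph (Fin (n + 1))}
    {φ : Fin (n + 1) → Fin (n + 1) → ℝ → ℝ} {ψ : Fin n → Fin n → ℝ → ℝ}
    (hφ : ∀ i j, φ i j = φ j i) {a : Fin (n + 1) → ℝ} {c : ℝ}
    (hc : c ≠ 0) (h0 : FMat G φ a 0 0 = c)
    (h : ∀ i j, i ≠ j → FMat (G.comap Fin.succ) ψ (a ∘ Fin.succ) i j
      = FMat G φ a i.succ j.succ - c⁻¹ * FMat G φ a 0 i.succ * FMat G φ a 0 j.succ)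
    (i j : Fin n) :
    FMat G φ a i.succ j.succ = FMat (G.comap Fin.succ) ψ (a ∘ Fin.succ) i j
      + c⁻¹ * FMat G φ a 0 i.succ * FMat G φ a 0 j.succ := by
  by_cases hij : i = j
  · subst hij
    have hrow : ∀ {N : ℕ} (H : SimpleGraph (Fin N)) (χ : Fin N → Fin N → ℝ → ℝ)
        (b : Fin N → ℝ) (k : Fin N), ∑ l, FMat H χ b k l = 0 := by
      intro N H χ b k
      rw [← Finset.add_sum_erase _ _ (Finset.mem_univ k)]
      have hz : (if H.Adj k k then χ k k |b k - b k| else 0) = 0 := if_neg (H.loopless.irrefl k)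
      have hd : FMat H χ b k k = -∑ l, if H.Adj k l then χ k l |b k - b l| else 0 := by
        simp [FMat]
      rw [hd, ← Finset.add_sum_erase _ _ (Finset.mem_univ k), hz, zero_add, neg_add_eq_zero]
      refine Finset.sum_congr rfl fun l hl => ?_
      simp [FMat, (Finset.ne_of_mem_erase hl).symm]
    have h1 := hrow G φ a i.succ
    have h2 := hrow (G.comap Fin.succ) ψ (a ∘ Fin.succ) i
    have h3 := hrow G φ a 0
    rw [Fin.sum_univ_succ, ← Finset.add_sum_erase _ _ (Finset.mem_univ i)] at h1
    rw [← Finset.add_sum_erase _ _ (Finset.mem_univ i),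
      Finset.sum_congr rfl fun j hj => h i j (Finset.ne_of_mem_erase hj).symm,
      Finset.sum_sub_distrib, ← Finset.mul_sum] at h2
    rw [Fin.sum_univ_succ, ← Finset.add_sum_erase _ _ (Finset.mem_univ i), h0] at h3
    have h4 : FMat G φ a i.succ 0 = FMat G φ a 0 i.succ := (FMat_isHermitian hφ a).apply 0 i.succ
    rw [h4] at h1
    rw [show ∑ j ∈ Finset.univ.erase i, FMat G φ a 0 j.succ = -c - FMat G φ a 0 i.succ by
      linarith] at h2
    have h5 : c⁻¹ * FMat G φ a 0 i.succ * (-c - FMat G φ a 0 i.succ)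
        = -FMat G φ a 0 i.succ - c⁻¹ * FMat G φ a 0 i.succ * FMat G φ a 0 i.succ := by
      field_simp
    rw [h5] at h2
    linarith
  · rw [h i j hij]
    ring

/-- `𝐧(d̃F_p) − 𝐧(d̃F_{p*}) = sgn(−f̃′₁₂(d₁₂) − f̃′₁₃(d₁₃))`, where `d̃F_{p*}`
is the matrix of the reduced system associated with `p` at `p*`. -/
theorem statement4 {n : ℕ} (G : SimpleGraph (Fin (n+3))) (hG : IsTLG G)
    (h0 : G.neighborSet 0 = {1, 2}) (h12 : G.Adj 1 2)
    (f : Fin (n+3) → Fin (n+3) → ℝ → ℝ)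
    (hsym : ∀ i j, f i j = f j i)
    (hF : ∀ i j, G.Adj i j → MemF (f i j))
    (a : Fin (n+3) → ℝ)
    (hP : ∀ i j, G.Adj i j → a i ≠ a j)
    (heq : IsEquilibrium G f (lineConfig a)) :
    inertia (dFMat G f a)
      = inertia (dFMat (G.comap Fin.succ)
            (reducedLaws f (virtualG (f 0 1) (f 0 2) (a 0) (a 1) (a 2))) (a ∘ Fin.succ))
        + sgn3 (-(deriv (tildeFn (f 0 1)) |a 0 - a 1|)
                - deriv (tildeFn (f 0 2)) |a 0 - a 2|) := by
  have hadj : ∀ j, G.Adj 0 j ↔ j = 1 ∨ j = 2 := fun j => by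
    rw [← SimpleGraph.mem_neighborSet, h0]; rfl
  have h01 : G.Adj 0 1 := (hadj 1).2 (Or.inl rfl)
  have h02 : G.Adj 0 2 := (hadj 2).2 (Or.inr rfl)
  have hα : 0 < deriv (tildeFn (f 0 1)) |a 0 - a 1| :=
    (hF 0 1 h01).2.1 _ (abs_pos.2 (sub_ne_zero.2 (hP 0 1 h01)))
  have hβ : 0 < deriv (tildeFn (f 0 2)) |a 0 - a 2| :=
    (hF 0 2 h02).2.1 _ (abs_pos.2 (sub_ne_zero.2 (hP 0 2 h02)))
  have hvirt := hasDerivAt_tildeFn_virtualG (hF 0 1 h01) (hF 0 2 h02) (hP 0 1 h01) (hP 0 2 h02)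
    (hP 1 2 h12) (heq.balance_zero h0)
  set g := virtualG (f 0 1) (f 0 2) (a 0) (a 1) (a 2)
  set α := deriv (tildeFn (f 0 1)) |a 0 - a 1| with hα_def
  set β := deriv (tildeFn (f 0 2)) |a 0 - a 2| with hβ_def
  have hc : -α - β ≠ 0 := by linarith
  have hφ : ∀ i j, (fun d => deriv (tildeFn (f i j)) d) = fun d => deriv (tildeFn (f j i)) d :=
    fun i j => by rw [hsym i j]
  have hψ : ∀ i j : Fin (n + 2), (fun d => deriv (tildeFn (reducedLaws f g i j)) d)
      = fun d => deriv (tildeFn (reducedLaws f g j i)) d := fun i j => by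
    have : reducedLaws f g i j = reducedLaws f g j i := by
      simp only [reducedLaws, hsym i.succ j.succ]
      exact if_congr (by tauto) rfl rfl
    rw [this]
  have h00 : dFMat G f a 0 0 = -α - β := by
    simp only [dFMat, FMat, Matrix.of_apply, if_pos]
    rw [sum_neighbors_zero h0 fun k => deriv (tildeFn (f 0 k)) |a 0 - a k|, neg_add']
  have hrow0 : ∀ j : Fin (n + 2), dFMat G f a 0 j.succ
      = if j = 0 then α else if j = 1 then β else 0 := by
    intro j
    rw [dFMat_apply_of_ne _ _ _ (Fin.succ_ne_zero j).symm]
    split_ifs with h1 h2 h3 h2 h3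
    · subst h2; rfl
    · subst h3; rfl
    · rcases (hadj _).1 h1 with h | h
      · exact absurd (Fin.succ_injective _ (h.trans Fin.succ_zero_eq_one.symm)) h2
      · exact absurd (Fin.succ_injective _ (h.trans Fin.succ_one_eq_two.symm)) h3
    · subst h2; exact absurd h01 h1
    · subst h3; exact absurd h02 h1
    · rfl
  have hlaw : deriv (tildeFn fun d => f 1 2 d + g d) |a 1 - a 2|
      = deriv (tildeFn (f 1 2)) |a 1 - a 2| + α * β / (α + β) := by
    rw [tildeFn_add]
    exact (((hF 1 2 h12).hasStrictDerivAt
      (abs_pos.2 (sub_ne_zero.2 (hP 1 2 h12)))).hasDerivAt.add hvirt).deriv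
  refine inertia_eq_add_sgn3_of_schur (FMat_isHermitian hφ a) (FMat_isHermitian hψ _) hc h00
    (FMat_succ_succ hφ hc h00 fun i j hij => ?_)
  change dFMat _ _ _ i j = dFMat G f a _ _ - _ * dFMat G f a _ _ * dFMat G f a _ _
  rw [hrow0, hrow0]
  have hentry : dFMat (G.comap Fin.succ) (reducedLaws f g) (a ∘ Fin.succ) i j
      = if G.Adj i.succ j.succ
        then deriv (tildeFn (reducedLaws f g i j)) |a i.succ - a j.succ| else 0 :=
    dFMat_apply_of_ne _ _ _ hij
  have hschur : (-α - β)⁻¹ * α * β = -(α * β / (α + β)) := by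
    rw [show -α - β = -(α + β) by ring, inv_neg]
    ring
  rw [dFMat_apply_of_ne _ _ _ ((Fin.succ_injective _).ne hij), hentry]
  by_cases hpair : (i = 0 ∧ j = 1) ∨ (i = 1 ∧ j = 0)
  · rw [reducedLaws, if_pos hpair]
    rcases hpair with ⟨rfl, rfl⟩ | ⟨rfl, rfl⟩
    · rw [Fin.succ_zero_eq_one, Fin.succ_one_eq_two, if_pos h12, if_pos h12, hlaw, if_pos rfl,
        if_neg hij.symm, if_pos rfl, hschur, sub_neg_eq_add]
    · rw [Fin.succ_zero_eq_one, Fin.succ_one_eq_two, if_pos h12.symm, if_pos h12.symm,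
        hsym 2 1, abs_sub_comm, hlaw, if_pos rfl, if_neg hij, if_pos rfl, mul_right_comm, hschur,
        sub_neg_eq_add]
  · rw [reducedLaws, if_neg hpair]
    have hzero : (-α - β)⁻¹ * (if i = 0 then α else if i = 1 then β else 0)
        * (if j = 0 then α else if j = 1 then β else 0) = 0 := by
      split_ifs <;> simp_all
    rw [hzero, sub_zero]
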